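/- Let ℕ_∨ be the semigroup (ℕ, ∨) with m∨n = max{m,n}, whose semigroup algebra ℓ¹(ℕ_∨) has character space {φ_n : n ∈ ℕ∪{∞}} where φ_n(Σ_i α_i δ_i) = Σ_{i=1}^n α_i. Then ℓ¹(ℕ_∨) is approximately left character biprojective (in particular approximately left φ_∞-biprojective), but ℓ¹(ℕ_∨) is not φ_∞-biprojective. -/

import Mathlib

open Filter Topology

universe u

/-! ## Nets indexed by directed sets -/

/-- A (nonempty) directed index type, used to index nets. -/
structure DirSys : Type (u + 1) where
  ι : Type u
  [pre : Preorder ι]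
  [dir : IsDirected ι (· ≤ ·)]
  [ne : Nonempty ι]

attribute [instance] DirSys.pre DirSys.dir DirSys.ne

section Core

variable (A : Type u) [NonUnitalNormedRing A] [NormedSpace ℂ A]
  [IsScalarTower ℂ A A] [SMulCommClass ℂ A A]

/-- A realization of the projective tensor product `A ⊗̂ A` of a Banach algebra `A` with
itself, together with its canonical Banach `A`-bimodule structure and the product
(diagonal) map `π_A`.  The field `universal` is the universal property of the projective
tensor norm, which pins the object down uniquely up to isometric isomorphism. -/
structure ProjTensorSq (X : Type u) [NormedAddCommGroup X] [NormedSpace ℂ X]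
    [CompleteSpace X] : Type (u + 1) where
  /-- the canonical bilinear map `(a, b) ↦ a ⊗ b` -/
  tmul : A →L[ℂ] A →L[ℂ] X
  /-- the projective norm is a cross norm -/
  norm_tmul : ∀ a b : A, ‖tmul a b‖ = ‖a‖ * ‖b‖
  /-- elementary tensors span a dense subspace -/
  dense_span : Dense (Submodule.span ℂ (Set.range fun p : A × A => tmul p.1 p.2) : Set X)
  /-- the universal property of the projective tensor product -/
  universal : ∀ (Y : Type u) [NormedAddCommGroup Y] [NormedSpace ℂ Y] [CompleteSpace Y]
      (f : A →L[ℂ] A →L[ℂ] Y), ∃ g : X →L[ℂ] Y, ‖g‖ ≤ ‖f‖ ∧ ∀ a b : A, g (tmul a b) = f a b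
  /-- the left module action `a · (b ⊗ c) = (a * b) ⊗ c` -/
  lsmul : A →L[ℂ] X →L[ℂ] X
  lsmul_tmul : ∀ a b c : A, lsmul a (tmul b c) = tmul (a * b) c
  /-- the right module action `(b ⊗ c) · a = b ⊗ (c * a)` -/
  rsmul : A →L[ℂ] X →L[ℂ] X
  rsmul_tmul : ∀ a b c : A, rsmul a (tmul b c) = tmul b (c * a)
  /-- the product map `π_A`, determined by `π_A (a ⊗ b) = a * b` -/
  projL : X →L[ℂ] A
  projL_tmul : ∀ a b : A, projL (tmul a b) = a * b

variable {A}

/-- `A` is approximately left `φ`-biprojective:  there is a net `(ρ_α)` of bounded linear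
maps `A → A ⊗̂ A` with `a·ρ_α(x) - ρ_α(ax) → 0`, `ρ_α(xa) - φ(a)ρ_α(x) → 0` and
`φ(π_A(ρ_α(x))) → φ(x)` for all `a x : A`. -/
def ApproxLeftBiprojective (φ : WeakDual.characterSpace ℂ A) : Prop :=
  ∀ (X : Type u) [NormedAddCommGroup X] [NormedSpace ℂ X] [CompleteSpace X]
    (P : ProjTensorSq A X),
    ∃ (D : DirSys.{u}) (ρ : D.ι → (A →L[ℂ] X)),
      (∀ a x : A, Tendsto (fun i => P.lsmul a (ρ i x) - ρ i (a * x)) atTop (𝓝 0)) ∧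
      (∀ a x : A, Tendsto (fun i => ρ i (x * a) - φ a • ρ i x) atTop (𝓝 0)) ∧
      (∀ x : A, Tendsto (fun i => φ (P.projL (ρ i x))) atTop (𝓝 (φ x)))

/-- `A` is approximately left character biprojective if it is approximately left
`φ`-biprojective for every character `φ` of `A`. -/
def ApproxLeftCharBiprojective : Prop :=
  ∀ φ : WeakDual.characterSpace ℂ A, ApproxLeftBiprojective φ

/-- `A` is approximately left `φ`-amenable: there is a (not necessarily bounded) net
`(a_α)` in `A` with `‖a * a_α - φ(a) a_α‖ → 0` for every `a` and `φ(a_α) → 1`. -/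
def ApproxLeftAmenable (φ : WeakDual.characterSpace ℂ A) : Prop :=
  ∃ (D : DirSys.{u}) (v : D.ι → A),
    (∀ a : A, Tendsto (fun i => a * v i - φ a • v i) atTop (𝓝 0)) ∧
    Tendsto (fun i => φ (v i)) atTop (𝓝 1)

/-- `A` is approximately biprojective (Zhang): there is a net `(ρ_α)` of bounded
`A`-bimodule morphisms `A → A ⊗̂ A` with `π_A(ρ_α(a)) → a` for every `a`. -/
def ApproxBiprojective : Prop :=
  ∀ (X : Type u) [NormedAddCommGroup X] [NormedSpace ℂ X] [CompleteSpace X]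
    (P : ProjTensorSq A X),
    ∃ (D : DirSys.{u}) (ρ : D.ι → (A →L[ℂ] X)),
      (∀ i, ∀ a b : A, ρ i (a * b) = P.lsmul a (ρ i b)) ∧
      (∀ i, ∀ a b : A, ρ i (a * b) = P.rsmul b (ρ i a)) ∧
      (∀ a : A, Tendsto (fun i => P.projL (ρ i a)) atTop (𝓝 a))

/-- `A` is pseudo-amenable: there is a (not necessarily bounded) net `(m_α)` in `A ⊗̂ A`
with `a·m_α - m_α·a → 0` and `π_A(m_α) a → a` for every `a`. -/
def PseudoAmenable : Prop :=
  ∀ (X : Type u) [NormedAddCommGroup X] [NormedSpace ℂ X] [CompleteSpace X]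
    (P : ProjTensorSq A X),
    ∃ (D : DirSys.{u}) (m : D.ι → X),
      (∀ a : A, Tendsto (fun i => P.lsmul a (m i) - P.rsmul a (m i)) atTop (𝓝 0)) ∧
      (∀ a : A, Tendsto (fun i => P.projL (m i) * a - a) atTop (𝓝 0))

end Core
section SemigroupAlgebra

/-- A model of the semigroup algebra `ℓ¹(S)` of a (discrete) semigroup `S`: a Banach
algebra `A` isometrically isomorphic, as a Banach space, to `ℓ¹(S)`, whose
multiplication corresponds to the convolution
`(f * g)(s) = ∑_{uv = s} f(u) g(v)`. -/
structure L1SemigroupModel (S : Type) [Semigroup S] (A : Type) [NonUnitalNormedRing A]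
    [NormedSpace ℂ A] (T : A ≃ₗᵢ[ℂ] lp (fun _ : S => ℂ) 1) : Prop where
  mul_eq : ∀ (f g : A) (s : S),
    (T (f * g) : ∀ _ : S, ℂ) s =
      ∑' p : {p : S × S // p.1 * p.2 = s}, (T f : ∀ _ : S, ℂ) p.1.1 * (T g : ∀ _ : S, ℂ) p.1.2

end SemigroupAlgebra

/-- `A` is `φ`-biprojective: there is a bounded `A`-bimodule morphism
`ρ : A → A ⊗̂ A` with `φ(π_A(ρ(a))) = φ(a)` for every `a ∈ A`. -/
def PhiBiprojective {A : Type u} [NonUnitalNormedRing A] [NormedSpace ℂ A]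
    [IsScalarTower ℂ A A] [SMulCommClass ℂ A A]
    (φ : WeakDual.characterSpace ℂ A) : Prop :=
  ∀ (X : Type u) [NormedAddCommGroup X] [NormedSpace ℂ X] [CompleteSpace X]
    (P : ProjTensorSq A X),
    ∃ ρ : A →L[ℂ] X,
      (∀ a b : A, ρ (a * b) = P.lsmul a (ρ b)) ∧
      (∀ a b : A, ρ (a * b) = P.rsmul b (ρ a)) ∧
      (∀ a : A, φ (P.projL (ρ a)) = φ a)

/-- The semigroup `ℕ_∨ = (ℕ, max)`. -/
def NatVee : Type := ℕ

instance : Semigroup NatVee where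
  mul m n := Nat.max m n
  mul_assoc := Nat.max_assoc

section L1

/-- The norm of `ℓ¹(ι)` is the sum of the norms of the coordinates. -/
theorem hasSum_norm_l1 {ι : Type*} (x : lp (fun _ : ι => ℂ) 1) : HasSum (fun i => ‖x i‖) ‖x‖ := by
  simpa using lp.hasSum_norm (p := 1) (by simp) x

variable {ι : Type*} [DecidableEq ι]

/-- Every element of `ℓ¹(ι)` is the sum of its coordinates times the point masses. -/
theorem hasSum_smul_single (x : lp (fun _ : ι => ℂ) 1) :
    HasSum (fun i => x i • lp.single (E := fun _ : ι => ℂ) 1 i (1 : ℂ)) x := by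
  have h := lp.hasSum_single (p := 1) (by simp) x
  refine h.congr_fun ?_
  intro i
  rw [← lp.single_smul, smul_eq_mul, mul_one]

/-- A bounded family in a Banach space extends linearly to `ℓ¹(ι)`, with the same bound. -/
theorem exists_l1_lift {Y : Type*} [NormedAddCommGroup Y] [NormedSpace ℂ Y] [CompleteSpace Y]
    (F : ι → Y) (C : ℝ) (hC : 0 ≤ C) (hF : ∀ i, ‖F i‖ ≤ C) :
    ∃ g : lp (fun _ : ι => ℂ) 1 →L[ℂ] Y, ‖g‖ ≤ C ∧ ∀ i, g (lp.single 1 i 1) = F i := by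
  have hb (x : lp (fun _ : ι => ℂ) 1) (i : ι) : ‖x i • F i‖ ≤ C * ‖x i‖ := by
    rw [norm_smul, mul_comm]
    gcongr
    exact hF i
  have hs (x : lp (fun _ : ι => ℂ) 1) : Summable fun i => x i • F i :=
    .of_norm_bounded ((hasSum_norm_l1 x).summable.mul_left C) (hb x)
  let g : lp (fun _ : ι => ℂ) 1 →ₗ[ℂ] Y :=
    { toFun x := ∑' i, x i • F i
      map_add' x y := by
        simp only [lp.coeFn_add, Pi.add_apply, add_smul]
        exact (hs x).tsum_add (hs y)
      map_smul' c x := by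
        simp only [lp.coeFn_smul, Pi.smul_apply, smul_eq_mul, mul_smul, RingHom.id_apply]
        exact (hs x).tsum_const_smul c }
  refine ⟨g.mkContinuous C fun x => ?_, LinearMap.mkContinuous_norm_le _ hC _, fun i => ?_⟩
  · exact tsum_of_norm_bounded ((hasSum_norm_l1 x).mul_left C) (hb x)
  · change ∑' j, lp.single (E := fun _ : ι => ℂ) 1 i (1 : ℂ) j • F j = F i
    rw [tsum_eq_single i]
    · simp
    · intro j hj
      simp [hj]

end L1

section PointMass

variable {ι A : Type*} [DecidableEq ι] [NormedAddCommGroup A] [NormedSpace ℂ A]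

/-- The point mass at `i` in an isometric copy of `ℓ¹(ι)`. -/
noncomputable def pointMass (T : A ≃ₗᵢ[ℂ] lp (fun _ : ι => ℂ) 1) (i : ι) : A :=
  T.symm (lp.single 1 i 1)

variable (T : A ≃ₗᵢ[ℂ] lp (fun _ : ι => ℂ) 1)

theorem apply_pointMass (i j : ι) :
    (T (pointMass T i) : ∀ _ : ι, ℂ) j = if j = i then 1 else 0 := by
  simp [pointMass, lp.single_apply, Pi.single_apply]

theorem norm_pointMass (i : ι) : ‖pointMass T i‖ = 1 := by
  simp [pointMass, lp.norm_single]

theorem hasSum_smul_pointMass (a : A) :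
    HasSum (fun i => (T a : ∀ _ : ι, ℂ) i • pointMass T i) a := by
  have h := (hasSum_smul_single (T a)).mapL (T.symm.toContinuousLinearEquiv : _ →L[ℂ] A)
  simpa [pointMass] using h

theorem clm_ext_pointMass {Y : Type*} [NormedAddCommGroup Y] [NormedSpace ℂ Y]
    {f g : A →L[ℂ] Y} (h : ∀ i, f (pointMass T i) = g (pointMass T i)) : f = g := by
  ext a
  have hf := (hasSum_smul_pointMass T a).mapL f
  have hg := (hasSum_smul_pointMass T a).mapL g
  simp only [map_smul, h] at hf hg
  exact hf.unique hg

/-- A uniformly bounded sequence of operators that tends to zero on the point masses tends to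
zero strongly. -/
theorem tendsto_zero_of_pointMass {Y : Type*} [NormedAddCommGroup Y] [NormedSpace ℂ Y]
    [CompleteSpace Y] (L : ℕ → A →L[ℂ] Y) (C : ℝ) (hC : ∀ k, ‖L k‖ ≤ C)
    (h : ∀ i, Tendsto (fun k => L k (pointMass T i)) atTop (𝓝 0)) (a : A) :
    Tendsto (fun k => L k a) atTop (𝓝 0) := by
  have hL (k : ℕ) : ∑' i, (T a : ∀ _ : ι, ℂ) i • L k (pointMass T i) = L k a := by
    simpa using ((hasSum_smul_pointMass T a).mapL (L k)).tsum_eq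
  simp only [← hL]
  rw [← tsum_zero (α := Y) (β := ι)]
  refine tendsto_tsum_of_dominated_convergence (bound := fun i => C * ‖(T a : ∀ _ : ι, ℂ) i‖)
    ((hasSum_norm_l1 (T a)).summable.mul_left C) (fun i => ?_) (.of_forall fun k i => ?_)
  · simpa using (h i).const_smul ((T a : ∀ _ : ι, ℂ) i)
  · rw [norm_smul, mul_comm]
    gcongr
    simpa [norm_pointMass] using (L k).le_of_opNorm_le (hC k) (pointMass T i)

end PointMass

section Tensor

variable {ι A : Type} [NormedAddCommGroup A] [NormedSpace ℂ A]
  (T : A ≃ₗᵢ[ℂ] lp (fun _ : ι => ℂ) 1)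

theorem hasSum_norm_mul_coord (a b : A) :
    HasSum (fun p : ι × ι => ‖(T a : ∀ _ : ι, ℂ) p.1 * (T b : ∀ _ : ι, ℂ) p.2‖) (‖a‖ * ‖b‖) := by
  have ha : HasSum (fun i => ‖(T a : ∀ _ : ι, ℂ) i‖) ‖a‖ := T.norm_map a ▸ hasSum_norm_l1 (T a)
  have hb : HasSum (fun i => ‖(T b : ∀ _ : ι, ℂ) i‖) ‖b‖ := T.norm_map b ▸ hasSum_norm_l1 (T b)
  generalize (T a : ∀ _ : ι, ℂ) = f at ha ⊢
  generalize (T b : ∀ _ : ι, ℂ) = g at hb ⊢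
  simp only [norm_mul]
  have hs := ha.summable.mul_of_nonneg hb.summable (fun _ => norm_nonneg _)
    (fun _ => norm_nonneg _)
  exact ha.mul hb hs

/-- The product `(i, j) ↦ a i * b j` as an element of `ℓ¹(ι × ι)`. -/
noncomputable def l1Tensor (a b : A) : lp (fun _ : ι × ι => ℂ) 1 :=
  ⟨fun p => (T a : ∀ _ : ι, ℂ) p.1 * (T b : ∀ _ : ι, ℂ) p.2, memℓp_gen (by
    simpa using (hasSum_norm_mul_coord T a b).summable)⟩

theorem norm_l1Tensor (a b : A) : ‖l1Tensor T a b‖ = ‖a‖ * ‖b‖ :=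
  (hasSum_norm_l1 (l1Tensor T a b)).unique (hasSum_norm_mul_coord T a b)

/-- The canonical bilinear map `A × A → ℓ¹(ι × ι)`. -/
noncomputable def l1TensorL : A →L[ℂ] A →L[ℂ] lp (fun _ : ι × ι => ℂ) 1 :=
  LinearMap.mkContinuous₂
    (LinearMap.mk₂ ℂ (l1Tensor T)
      (fun a b c => by ext p; simp [l1Tensor, add_mul]; rfl)
      (fun c a b => by ext p; simp [l1Tensor, mul_assoc])
      (fun a b c => by ext p; simp [l1Tensor, mul_add]; rfl)
      (fun c a b => by ext p; simp [l1Tensor, mul_left_comm]))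
    1 fun a b => by simp [norm_l1Tensor]

theorem l1TensorL_apply (a b : A) : l1TensorL T a b = l1Tensor T a b := rfl

variable [DecidableEq ι]

theorem l1TensorL_pointMass (i j : ι) :
    l1TensorL T (pointMass T i) (pointMass T j) = lp.single 1 (i, j) 1 := by
  ext ⟨k, l⟩
  simp only [l1TensorL_apply, l1Tensor, apply_pointMass, lp.single_apply, Pi.single_apply,
    Prod.mk.injEq]
  split_ifs <;> simp_all

theorem l1TensorL_dense :
    Dense (Submodule.span ℂ (Set.range fun p : A × A => l1TensorL T p.1 p.2) :
      Set (lp (fun _ : ι × ι => ℂ) 1)) := by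
  intro x
  refine mem_closure_of_tendsto (hasSum_smul_single x)
    (.of_forall fun s => Submodule.sum_mem _ fun p _ => Submodule.smul_mem _ _ ?_)
  exact Submodule.subset_span ⟨(pointMass T p.1, pointMass T p.2), l1TensorL_pointMass T p.1 p.2⟩

theorem l1TensorL_universal {Y : Type*} [NormedAddCommGroup Y] [NormedSpace ℂ Y] [CompleteSpace Y]
    (f : A →L[ℂ] A →L[ℂ] Y) :
    ∃ g : lp (fun _ : ι × ι => ℂ) 1 →L[ℂ] Y, ‖g‖ ≤ ‖f‖ ∧ ∀ a b, g (l1TensorL T a b) = f a b := by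
  obtain ⟨g, hg, hgs⟩ := exists_l1_lift
    (fun p : ι × ι => f (pointMass T p.1) (pointMass T p.2)) ‖f‖ (norm_nonneg f)
    (fun p => by simpa [norm_pointMass] using f.le_opNorm₂ (pointMass T p.1) (pointMass T p.2))
  refine ⟨g, hg, fun a b => ?_⟩
  have h1 (j : ι) : g ∘L (l1TensorL T).flip (pointMass T j) = f.flip (pointMass T j) :=
    clm_ext_pointMass T fun i => by simp [l1TensorL_pointMass, hgs]
  have h2 : g ∘L l1TensorL T a = f a :=
    clm_ext_pointMass T fun j => by simpa using DFunLike.congr_fun (h1 j) a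
  exact DFunLike.congr_fun h2 b

end Tensor

/-- `ℓ¹(ι × ι)` realizes the projective tensor square of a Banach algebra isometric to `ℓ¹(ι)`. -/
theorem nonempty_projTensorSq {ι A : Type} [DecidableEq ι] [NonUnitalNormedRing A]
    [NormedSpace ℂ A] [IsScalarTower ℂ A A] [SMulCommClass ℂ A A] [CompleteSpace A]
    (T : A ≃ₗᵢ[ℂ] lp (fun _ : ι => ℂ) 1) :
    Nonempty (ProjTensorSq A (lp (fun _ : ι × ι => ℂ) 1)) := by
  let X := lp (fun _ : ι × ι => ℂ) 1
  let t : A →L[ℂ] A →L[ℂ] X := l1TensorL T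
  let m := ContinuousLinearMap.mul ℂ A
  obtain ⟨l, -, hl⟩ := l1TensorL_universal T
    (((ContinuousLinearMap.compL ℂ A (A →L[ℂ] X) (A →L[ℂ] X)).flip t.flip) ∘L
      ((ContinuousLinearMap.compL ℂ A A X).flip ∘L m.flip))
  obtain ⟨r, -, hr⟩ := l1TensorL_universal T
    (((ContinuousLinearMap.compL ℂ A (A →L[ℂ] A) (A →L[ℂ] X)).flip m) ∘L
      ((ContinuousLinearMap.compL ℂ A A X) ∘L t))
  obtain ⟨q, -, hq⟩ := l1TensorL_universal T m
  exact ⟨{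
    tmul := t
    norm_tmul := norm_l1Tensor T
    dense_span := l1TensorL_dense T
    universal := fun Y _ _ _ f => l1TensorL_universal T f
    lsmul := l.flip
    lsmul_tmul := fun a b c => DFunLike.congr_fun (hl b c) a
    rsmul := r.flip
    rsmul_tmul := fun a b c => DFunLike.congr_fun (hr b c) a
    projL := q
    projL_tmul := hq }⟩

section Character

variable {A : Type} [NonUnitalNormedRing A] [NormedSpace ℂ A]

/-- Bounded linear maps on a projective tensor square agree if they agree on elementary tensors. -/
theorem ProjTensorSq.clm_ext {X : Type} [NormedAddCommGroup X] [NormedSpace ℂ X] [CompleteSpace X]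
    (P : ProjTensorSq A X) {Y : Type*} [NormedAddCommGroup Y] [NormedSpace ℂ Y]
    {f g : X →L[ℂ] Y} (h : ∀ a b, f (P.tmul a b) = g (P.tmul a b)) : f = g :=
  ContinuousLinearMap.ext_on P.dense_span (by rintro _ ⟨p, rfl⟩; exact h p.1 p.2)

/-- A bounded sequence witnessing approximate left `φ`-amenability yields approximate left
`φ`-biprojectivity, through `x ↦ φ x • (v k ⊗ v k)`. -/
theorem approxLeftBiprojective_of_bounded (φ : WeakDual.characterSpace ℂ A) (v : ℕ → A) (C : ℝ)
    (hC : ∀ k, ‖v k‖ ≤ C) (hφ : ∀ k, φ (v k) = 1)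
    (hv : ∀ a, Tendsto (fun k => a * v k - φ a • v k) atTop (𝓝 0)) :
    ApproxLeftBiprojective φ := by
  intro X _ _ _ P
  let D : DirSys := { ι := ℕ }
  refine ⟨D, fun k : ℕ => (WeakDual.CharacterSpace.toCLM φ).smulRight (P.tmul (v k) (v k)),
    fun a x => ?_, fun a x => ?_, fun x => ?_⟩
  · have key (k : ℕ) : P.lsmul a (φ x • P.tmul (v k) (v k)) - φ (a * x) • P.tmul (v k) (v k)
        = φ x • P.tmul (a * v k - φ a • v k) (v k) := by
      simp only [map_smul, P.lsmul_tmul, map_sub, map_mul, sub_apply,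
        smul_apply, smul_sub, smul_smul, mul_comm]
    change Tendsto (fun k : ℕ => P.lsmul a (φ x • P.tmul (v k) (v k)) -
      φ (a * x) • P.tmul (v k) (v k)) atTop (𝓝 0)
    simp only [key]
    rw [← smul_zero (φ x)]
    refine Tendsto.const_smul ?_ _
    refine squeeze_zero_norm (a := fun k => ‖a * v k - φ a • v k‖ * C) (fun k => ?_) ?_
    · rw [P.norm_tmul]
      gcongr
      exact hC k
    · simpa using (hv a).norm.mul_const C
  · have key (k : ℕ) : φ (x * a) • P.tmul (v k) (v k) - φ a • φ x • P.tmul (v k) (v k) = 0 := by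
      rw [map_mul, smul_smul, mul_comm, sub_self]
    change Tendsto (fun k : ℕ => φ (x * a) • P.tmul (v k) (v k) -
      φ a • φ x • P.tmul (v k) (v k)) atTop (𝓝 0)
    simp only [key, tendsto_const_nhds]
  · have key (k : ℕ) : φ (P.projL (φ x • P.tmul (v k) (v k))) = φ x := by
      rw [map_smul, P.projL_tmul, map_smul, map_mul, hφ, mul_one, smul_eq_mul, mul_one]
    change Tendsto (fun k : ℕ => φ (P.projL (φ x • P.tmul (v k) (v k)))) atTop (𝓝 (φ x))
    simp only [key, tendsto_const_nhds]

end Character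

section NatVee

instance : DecidableEq NatVee := inferInstanceAs (DecidableEq ℕ)

variable {A : Type} [NonUnitalNormedRing A] [NormedSpace ℂ A]
  {T : A ≃ₗᵢ[ℂ] lp (fun _ : NatVee => ℂ) 1}

namespace L1SemigroupModel

theorem pointMass_mul {S : Type} [Semigroup S] [DecidableEq S]
    {T : A ≃ₗᵢ[ℂ] lp (fun _ : S => ℂ) 1} (hA : L1SemigroupModel S A T) (m n : S) :
    pointMass T m * pointMass T n = pointMass T (m * n) := by
  apply T.injective
  ext s
  rw [hA.mul_eq, apply_pointMass]
  simp only [apply_pointMass, ← ite_and, mul_ite, mul_one, mul_zero]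
  split_ifs with h
  · subst h
    rw [tsum_eq_single ⟨(m, n), rfl⟩]
    · simp
    · rintro ⟨⟨k, l⟩, hp⟩ hne
      rw [if_neg]
      rintro ⟨h1, h2⟩
      exact hne (Subtype.ext (Prod.ext h2 h1))
  · rw [← tsum_zero]
    congr 1
    ext ⟨⟨k, l⟩, hp⟩
    rw [if_neg]
    rintro ⟨rfl, rfl⟩
    exact h hp.symm

/-- Multiplication by the point mass at `m` kills the coordinates below `m`. -/
theorem pointMass_mul_apply_of_lt (hA : L1SemigroupModel NatVee A T) (u : A) {i m : NatVee}
    (h : @LT.lt ℕ _ i m) : (T (pointMass T m * u) : ∀ _ : NatVee, ℂ) i = 0 := by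
  rw [hA.mul_eq, ← tsum_zero]
  congr 1
  ext ⟨⟨k, l⟩, hp⟩
  rw [apply_pointMass, if_neg, zero_mul]
  rintro rfl
  have hle : @LE.le ℕ _ k i := hp ▸ le_max_left (α := ℕ) k l
  exact absurd h (not_lt_of_ge hle)

theorem eq_zero_of_pointMass_mul (hA : L1SemigroupModel NatVee A T) {u : A}
    (h : ∀ m, pointMass T m * u = u) : u = 0 := by
  apply T.injective
  ext i
  let m : NatVee := Nat.succ i
  have hm : (T (pointMass T m * u) : ∀ _ : NatVee, ℂ) i = 0 :=
    hA.pointMass_mul_apply_of_lt u (Nat.lt_succ_self i)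
  rw [h] at hm
  simpa using hm

variable [IsScalarTower ℂ A A] [SMulCommClass ℂ A A]

theorem tendsto_mul_sub_smul [CompleteSpace A] (φ : WeakDual.characterSpace ℂ A) (v : ℕ → A) (C : ℝ)
    (hC : ∀ k, ‖v k‖ ≤ C)
    (h : ∀ m, ∀ᶠ k in atTop, pointMass T m * v k = φ (pointMass T m) • v k) (a : A) :
    Tendsto (fun k => a * v k - φ a • v k) atTop (𝓝 0) := by
  let L (k : ℕ) : A →L[ℂ] A := (ContinuousLinearMap.mul ℂ A).flip (v k) -
    (WeakDual.CharacterSpace.toCLM φ).smulRight (v k)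
  have hL (k : ℕ) : ‖L k‖ ≤ C + ‖WeakDual.CharacterSpace.toCLM φ‖ * C := by
    refine (norm_sub_le _ _).trans (add_le_add ?_ ?_)
    · refine ContinuousLinearMap.opNorm_le_bound _ ((norm_nonneg _).trans (hC k)) fun x => ?_
      refine (norm_mul_le x (v k)).trans ?_
      rw [mul_comm]
      gcongr
      exact hC k
    · rw [ContinuousLinearMap.norm_smulRight_apply]
      gcongr
      exact hC k
  refine tendsto_zero_of_pointMass T L _ hL (fun m => ?_) a
  refine tendsto_const_nhds.congr' ((h m).mono fun k hk => ?_)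
  exact (sub_eq_zero.mpr hk).symm

theorem approxLeftCharBiprojective [CompleteSpace A] (hA : L1SemigroupModel NatVee A T) :
    ApproxLeftCharBiprojective (A := A) := by
  intro φ
  let d (n : ℕ) : A := pointMass T (n : NatVee)
  have hd (m n : ℕ) : d m * d n = d (max m n) := hA.pointMass_mul m n
  have hφd (m n : ℕ) : φ (d m) * φ (d n) = φ (d (max m n)) := by rw [← map_mul, hd]
  have hn (n : ℕ) : ‖d n‖ = 1 := norm_pointMass T _
  have h01 (m : ℕ) (hm : φ (d m) ≠ 0) : φ (d m) = 1 := by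
    have := hφd m m
    rw [max_self] at this
    exact mul_left_cancel₀ hm (this.trans (mul_one _).symm)
  by_cases hz : ∃ m, φ (d m) = 0
  · classical
    obtain ⟨N, hN, hmin⟩ : ∃ N, φ (d N) = 0 ∧ ∀ m < N, φ (d m) ≠ 0 :=
      ⟨Nat.find hz, Nat.find_spec hz, fun m hm => Nat.find_min hz hm⟩
    have hlarge (m : ℕ) (hm : N ≤ m) : φ (d m) = 0 := by
      have := hφd N m
      rwa [hN, zero_mul, max_eq_right hm, eq_comm] at this
    obtain _ | n := N
    · exfalso
      have hφ0 : WeakDual.CharacterSpace.toCLM φ = 0 :=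
        clm_ext_pointMass T fun m => hlarge m (Nat.zero_le m)
      exact φ.2.1 (ContinuousLinearMap.ext fun a => DFunLike.congr_fun hφ0 a)
    · have hbd : ‖d n - d (n + 1)‖ ≤ 2 := by
        refine (norm_sub_le _ _).trans ?_
        rw [hn, hn]
        norm_num
      refine approxLeftBiprojective_of_bounded φ (fun _ => d n - d (n + 1)) 2 (fun _ => hbd)
        (fun _ => ?_) (tendsto_mul_sub_smul (T := T) φ _ 2 (fun _ => hbd)
          fun (m : ℕ) => .of_forall fun _ => ?_)
      · rw [map_sub, hN, h01 n (hmin n n.lt_succ_self), sub_zero]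
      · change d m * (d n - d (n + 1)) = φ (d m) • (d n - d (n + 1))
        rw [mul_sub, hd, hd]
        rcases lt_or_ge m (n + 1) with hm | hm
        · rw [h01 m (hmin m hm), one_smul, max_eq_right (by omega), max_eq_right (by omega)]
        · rw [hlarge m hm, zero_smul, max_eq_left (by omega), max_eq_left hm, sub_self]
  · push Not at hz
    refine approxLeftBiprojective_of_bounded φ d 1 (fun k => (hn k).le) (fun k => h01 k (hz k))
      (tendsto_mul_sub_smul (T := T) φ d 1 (fun k => (hn k).le) fun (m : ℕ) => ?_)
    filter_upwards [eventually_ge_atTop m] with k hk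
    change d m * d k = φ (d m) • d k
    rw [hd, max_eq_right hk, h01 m (hz m), one_smul]

theorem not_phiBiprojective [CompleteSpace A] (hA : L1SemigroupModel NatVee A T)
    (φ : WeakDual.characterSpace ℂ A) (hφ : ∀ m, φ (pointMass T m) = 1) :
    ¬ PhiBiprojective φ := by
  intro h
  obtain ⟨P⟩ := nonempty_projTensorSq T
  obtain ⟨ρ, hl, hr, hπ⟩ := h _ P
  let Φ := WeakDual.CharacterSpace.toCLM φ
  obtain ⟨R, -, hR⟩ := P.universal A
    (ContinuousLinearMap.smulRightL ℂ A A Φ)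
  have hRt (a b : A) : R (P.tmul a b) = φ b • a := hR a b
  let e : NatVee := (0 : ℕ)
  have hRl (a : A) : R ∘L P.lsmul a = (ContinuousLinearMap.mul ℂ A a) ∘L R :=
    P.clm_ext fun b c => by simp [P.lsmul_tmul, hRt]
  have hRr (a : A) : R ∘L P.rsmul a = φ a • R :=
    P.clm_ext fun b c => by simp [P.rsmul_tmul, hRt, smul_smul, mul_comm]
  have hRπ : Φ ∘L R = Φ ∘L P.projL :=
    P.clm_ext fun b c => by
      change φ (R (P.tmul b c)) = φ (P.projL (P.tmul b c))
      rw [hRt, P.projL_tmul, map_smul, map_mul, smul_eq_mul, mul_comm]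
  have hu : R (ρ (pointMass T e)) = 0 := by
    refine hA.eq_zero_of_pointMass_mul fun m => ?_
    have h1 : P.lsmul (pointMass T m) (ρ (pointMass T e)) =
        P.rsmul (pointMass T m) (ρ (pointMass T e)) := by
      rw [← hl, ← hr, hA.pointMass_mul, hA.pointMass_mul]
      congr 2
      exact max_comm (α := ℕ) m e
    have h2 := DFunLike.congr_fun (hRl (pointMass T m)) (ρ (pointMass T e))
    have h3 := DFunLike.congr_fun (hRr (pointMass T m)) (ρ (pointMass T e))
    rw [ContinuousLinearMap.comp_apply] at h2 h3
    rw [h1, h3, hφ, one_smul] at h2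
    exact h2.symm
  have h4 : φ (R (ρ (pointMass T e))) = φ (P.projL (ρ (pointMass T e))) :=
    DFunLike.congr_fun hRπ _
  rw [hu, map_zero, hπ, hφ] at h4
  exact zero_ne_one h4

end L1SemigroupModel

end NatVee

/-- Remark 4.1.  Consider the semigroup `ℕ_∨ = (ℕ, ∨)` with
`m ∨ n = max {m, n}` and its semigroup algebra `ℓ¹(ℕ_∨)`, and let `φ_∞` be the
character `φ_∞(∑ αᵢ δᵢ) = ∑ᵢ αᵢ`.  Then `ℓ¹(ℕ_∨)` is approximately left character
biprojective (in particular approximately left `φ_∞`-biprojective), but `ℓ¹(ℕ_∨)` is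
not `φ_∞`-biprojective. -/
theorem natVee_approxLeftCharBiprojective_not_phiInftyBiprojective
    (A : Type) [NonUnitalNormedRing A] [NormedSpace ℂ A]
    [IsScalarTower ℂ A A] [SMulCommClass ℂ A A] [CompleteSpace A]
    (T : A ≃ₗᵢ[ℂ] lp (fun _ : NatVee => ℂ) 1) (hA : L1SemigroupModel NatVee A T)
    (φinf : WeakDual.characterSpace ℂ A)
    (hφinf : ∀ f : A, φinf f = ∑' i : NatVee, (T f : ∀ _ : NatVee, ℂ) i) :
    ApproxLeftCharBiprojective (A := A) ∧ ApproxLeftBiprojective φinf ∧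
      ¬ PhiBiprojective φinf := by
  refine ⟨hA.approxLeftCharBiprojective, hA.approxLeftCharBiprojective φinf,
    hA.not_phiBiprojective φinf fun m => ?_⟩
  rw [hφinf]
  simp [apply_pointMass]
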